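/- Let E be a real Banach space with norm ‖·‖, and let q be a seminorm on E with ‖v‖ ≤ q(v) for all v ∈ E (i.e., q dominates the norm pointwise). Let γ, b, β be real numbers with γ > 1, b > 0, β > 0, and set ε = (γ+1)(b+β). Let f : E → ℝ be Fréchet differentiable at every point, and let c : E → ℝ satisfy: (i) c(x) > 0 for all x; (ii) ‖df_x‖ ≤ c(x) for all x, where ‖df_x‖ is the operator norm (with respect to ‖·‖) of the Fréchet derivative of f at x; (iii) c(x) ≤ exp(β·‖x′−x‖)·c(x′) for all x, x′. Let μ be the probability measure on ℝ with density proportional to z ↦ 1/(1+|z|^γ). Then for all x, x′ ∈ E and every measurable set S ⊆ ℝ, μ(z : f(x) + (c(x)/b)·z ∈ S) ≤ exp(ε·q(x′−x)) · μ(z : f(x′) + (c(x′)/b)·z ∈ S); that is, the mechanism g(x) = f(x) + (c(x)/b)·η with η ~ μ is ε-differentially private with respect to any norm dominating ‖·‖. -/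

import Mathlib

open MeasureTheory Real

lemma aux_f {E : Type*} [NormedAddCommGroup E] [NormedSpace ℝ E]
    (β : ℝ) (hβ : 0 < β) (f : E → ℝ) (hf : Differentiable ℝ f) (c : E → ℝ)
    (hc_ub : ∀ x : E, ‖fderiv ℝ f x‖ ≤ c x)
    (hc_smooth : ∀ x x' : E, c x ≤ Real.exp (β * ‖x' - x‖) * c x') (x x' : E) :
    |f x - f x'| ≤ c x' * (Real.exp (β * ‖x' - x‖) - 1) / β := by
  set d := ‖x' - x‖ with hd
  have hg : ∀ t : ℝ, HasDerivAt (fun t : ℝ => f (x' + t • (x - x')) - f x')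
      (fderiv ℝ f (x' + t • (x - x')) (x - x')) t := by
    intro t
    have h1 : HasDerivAt (fun t : ℝ => x' + t • (x - x')) (x - x') t := by
      simpa using ((hasDerivAt_id t).smul_const (x - x')).const_add x'
    exact ((hf _).hasFDerivAt.comp_hasDerivAt t h1).sub_const _
  have hB : ∀ t : ℝ, HasDerivAt (fun t : ℝ => c x' * (Real.exp (β * (t * d)) - 1) / β)
      (c x' * Real.exp (β * (t * d)) * d) t := by
    intro t
    have h1 : HasDerivAt (fun t : ℝ => β * (t * d)) (β * (1 * d)) t :=
      ((hasDerivAt_id t).mul_const d).const_mul β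
    have := ((h1.exp.sub_const 1).const_mul (c x')).div_const β
    refine this.congr_deriv ?_
    field_simp
  have key := image_norm_le_of_norm_deriv_right_le_deriv_boundary
    (f := fun t : ℝ => f (x' + t • (x - x')) - f x')
    (f' := fun t => fderiv ℝ f (x' + t • (x - x')) (x - x'))
    (a := 0) (b := 1)
    (B := fun t : ℝ => c x' * (Real.exp (β * (t * d)) - 1) / β)
    (B' := fun t => c x' * Real.exp (β * (t * d)) * d)
    (fun t _ => (hg t).continuousAt.continuousWithinAt)
    (fun t _ => (hg t).hasDerivWithinAt)
    (by simp) hB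
    (by
      intro t ht
      refine (ContinuousLinearMap.le_opNorm _ _).trans ?_
      rw [norm_sub_rev x x', ← hd]
      refine mul_le_mul_of_nonneg_right ((hc_ub _).trans ?_) (norm_nonneg _)
      have h := hc_smooth (x' + t • (x - x')) x'
      have h2 : ‖x' - (x' + t • (x - x'))‖ = t * d := by
        rw [sub_add_cancel_left, norm_neg, norm_smul, Real.norm_of_nonneg ht.1,
          norm_sub_rev x x']
      rw [h2, mul_comm] at h
      exact h)
  have := key (Set.right_mem_Icc.2 zero_le_one)
  simpa using this

lemma aux_w (γ b β : ℝ) (hγ : 1 < γ) (hb : 0 < b) (hβ : 0 < β) (a d : ℝ) (ha : 0 ≤ a)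
    (hd : 0 ≤ d) :
    1 + (a * Real.exp (β * d) + b * (Real.exp (β * d) - 1) / β) ^ γ ≤
      Real.exp (γ * (b + β) * d) * (1 + a ^ γ) := by
  let w : ℝ → ℝ := fun s => a * Real.exp (β * s) + b * (Real.exp (β * s) - 1) / β
  have hw0 : ∀ s, 0 ≤ s → 0 ≤ w s := by
    intro s hs
    have : 1 ≤ Real.exp (β * s) := Real.one_le_exp (by positivity)
    have h2 : 0 ≤ Real.exp (β * s) - 1 := by linarith
    simp only [w]
    positivity
  have hw : ∀ s, HasDerivAt w (β * w s + b) s := by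
    intro s
    have h1 : HasDerivAt (fun t : ℝ => β * t) (β * 1) s := (hasDerivAt_id s).const_mul β
    have := (h1.exp.const_mul a).add (((h1.exp.sub_const 1).const_mul b).div_const β)
    refine HasDerivAt.congr_deriv this ?_
    simp only [w]
    field_simp
    ring
  have hF : ∀ s, HasDerivAt (fun s => Real.exp (-(γ * (b + β)) * s) * (1 + w s ^ γ))
      (Real.exp (-(γ * (b + β)) * s) * (-(γ * (b + β)) * 1) * (1 + w s ^ γ) +
        Real.exp (-(γ * (b + β)) * s) * ((β * w s + b) * γ * w s ^ (γ - 1))) s := by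
    intro s
    have h1 : HasDerivAt (fun t : ℝ => -(γ * (b + β)) * t) (-(γ * (b + β)) * 1) s :=
      (hasDerivAt_id s).const_mul _
    exact h1.exp.mul (((hw s).rpow_const (Or.inr hγ.le)).const_add 1)
  have hanti : AntitoneOn (fun s => Real.exp (-(γ * (b + β)) * s) * (1 + w s ^ γ))
      (Set.Ici 0) := by
    refine antitoneOn_of_deriv_nonpos (convex_Ici 0)
      (fun s _ => (hF s).continuousAt.continuousWithinAt)
      (fun s _ => (hF s).differentiableAt.differentiableWithinAt) ?_
    intro s hs
    rw [interior_Ici] at hs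
    rw [(hF s).deriv]
    have hs0 := hw0 s (le_of_lt hs)
    have e1 : w s * w s ^ (γ - 1) = w s ^ γ := by
      rcases hs0.eq_or_lt with h | h
      · rw [← h, Real.zero_rpow (by positivity : γ ≠ 0), zero_mul]
      · rw [Real.rpow_sub_one h.ne']; field_simp
    have e2 : w s ^ (γ - 1) ≤ 1 + w s ^ γ := by
      rcases le_total (w s) 1 with h | h
      · have := Real.rpow_le_one hs0 h (by linarith : 0 ≤ γ - 1)
        have := Real.rpow_nonneg hs0 γ
        linarith
      · have := Real.rpow_le_rpow_of_exponent_le h (by linarith : γ - 1 ≤ γ)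
        linarith
    have e3 : (β * w s + b) * w s ^ (γ - 1) ≤ (b + β) * (1 + w s ^ γ) := by
      have : (β * w s + b) * w s ^ (γ - 1) = β * w s ^ γ + b * w s ^ (γ - 1) := by
        rw [← e1]; ring
      rw [this]
      nlinarith [mul_le_mul_of_nonneg_left e2 hb.le]
    have : 0 ≤ Real.exp (-(γ * (b + β)) * s) * γ *
        ((b + β) * (1 + w s ^ γ) - (β * w s + b) * w s ^ (γ - 1)) :=
      mul_nonneg (by positivity) (by linarith)
    linarith
  have h := hanti (Set.mem_Ici.2 le_rfl) (Set.mem_Ici.2 hd) hd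
  have hw00 : w 0 = a := by simp [w]
  simp only [hw00, mul_zero, Real.exp_zero, one_mul] at h
  have h3 := mul_le_mul_of_nonneg_left h (Real.exp_pos (γ * (b + β) * d)).le
  rw [← mul_assoc, ← Real.exp_add] at h3
  simpa [w] using h3

lemma aux_affine (G : ℝ → ENNReal) (hG : Measurable G) (a e : ℝ) (ha : 0 < a) :
    ∫⁻ z, G z = ENNReal.ofReal a * ∫⁻ z, G (a * z + e) := by
  have h1 : ∫⁻ z, G z = ∫⁻ z, G (z + e) := (lintegral_add_right_eq_self G e).symm
  rw [h1]
  conv_lhs => rw [← Real.smul_map_volume_mul_left ha.ne']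
  rw [lintegral_smul_measure, lintegral_map (by fun_prop) (by fun_prop), abs_of_pos ha]
  rfl

/-- Theorem: the generalized-Cauchy noise mechanism scaled by a β-smooth upper
bound on the derivative sensitivity (computed w.r.t. the norm of `E`) is
ε-differentially private w.r.t. any seminorm `q` dominating the norm. -/
theorem derivative_sensitivity_cauchy_noise_dp_dominating_norm
    {E : Type*} [NormedAddCommGroup E] [NormedSpace ℝ E] [CompleteSpace E]
    (q : Seminorm ℝ E) (hq : ∀ v : E, ‖v‖ ≤ q v)
    (γ b β ε : ℝ) (hγ : 1 < γ) (hb : 0 < b) (hβ : 0 < β)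
    (hε : ε = (γ + 1) * (b + β))
    (f : E → ℝ) (hf : Differentiable ℝ f)
    (c : E → ℝ)
    (hc_pos : ∀ x : E, 0 < c x)
    (hc_ub : ∀ x : E, ‖fderiv ℝ f x‖ ≤ c x)
    (hc_smooth : ∀ x x' : E, c x ≤ Real.exp (β * ‖x' - x‖) * c x')
    (μ : Measure ℝ)
    (hμ : μ = volume.withDensity (fun z =>
      ENNReal.ofReal ((1 / (1 + |z| ^ γ)) / (∫ w : ℝ, 1 / (1 + |w| ^ γ)))))
    (x x' : E) (S : Set ℝ) (hS : MeasurableSet S) :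
    μ {z | f x + (c x / b) * z ∈ S} ≤
      ENNReal.ofReal (Real.exp (ε * q (x' - x))) *
        μ {z | f x' + (c x' / b) * z ∈ S} := by
  set Z := ∫ w : ℝ, 1 / (1 + |w| ^ γ) with hZ
  have hZ0 : 0 ≤ Z := integral_nonneg (fun w => by positivity)
  set h : ℝ → ENNReal := fun z => ENNReal.ofReal ((1 / (1 + |z| ^ γ)) / Z) with hh
  have hm : Measurable h := by
    simp only [hh]
    fun_prop
  have hcx := hc_pos x
  have hcx' := hc_pos x'
  set d := ‖x' - x‖ with hd
  have hd0 : 0 ≤ d := norm_nonneg _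
  have hmeas : ∀ y, MeasurableSet {z | f y + (c y / b) * z ∈ S} := fun y =>
    (by fun_prop : Measurable (fun z : ℝ => f y + (c y / b) * z)) hS
  have hε0 : 0 ≤ ε := by rw [hε]; exact mul_nonneg (by linarith) (by linarith)
  have hpt : ∀ z : ℝ, ENNReal.ofReal (c x' / c x) *
      h (c x' / c x * z + (f x' - f x) * b / c x) ≤
      ENNReal.ofReal (Real.exp (ε * q (x' - x))) * h z := by
    intro z
    simp only [hh]
    rw [← ENNReal.ofReal_mul (by positivity), ← ENNReal.ofReal_mul (by positivity)]
    apply ENNReal.ofReal_le_ofReal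
    set u := c x' / c x * z + (f x' - f x) * b / c x with hu
    have hz : z = c x / c x' * u + b * ((f x - f x') / c x') := by
      rw [hu]; field_simp; ring
    have hr : c x / c x' ≤ Real.exp (β * d) := by
      rw [div_le_iff₀ hcx']; exact hc_smooth x x'
    have hr' : c x' / c x ≤ Real.exp (β * d) := by
      rw [div_le_iff₀ hcx, hd, norm_sub_rev]; exact hc_smooth x' x
    have hfd : |f x - f x'| / c x' ≤ (Real.exp (β * d) - 1) / β := by
      rw [div_le_iff₀ hcx']
      refine (aux_f β hβ f hf c hc_ub hc_smooth x x').trans (le_of_eq ?_)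
      ring
    have hzb : |z| ≤ |u| * Real.exp (β * d) + b * (Real.exp (β * d) - 1) / β := by
      calc |z| ≤ |c x / c x' * u| + |b * ((f x - f x') / c x')| := by
            conv_lhs => rw [hz]
            exact abs_add_le _ _
        _ = c x / c x' * |u| + b * (|f x - f x'| / c x') := by
            rw [abs_mul, abs_mul, abs_div (f x - f x'), abs_of_pos hb, abs_of_pos hcx',
              abs_of_pos (div_pos hcx hcx')]
        _ ≤ Real.exp (β * d) * |u| + b * ((Real.exp (β * d) - 1) / β) := by gcongr
        _ = _ := by ring
    have hmain : 1 + |z| ^ γ ≤ Real.exp (γ * (b + β) * d) * (1 + |u| ^ γ) := by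
      refine le_trans ?_ (aux_w γ b β hγ hb hβ |u| d (abs_nonneg u) hd0)
      have := Real.rpow_le_rpow (abs_nonneg z) hzb (by linarith : 0 ≤ γ)
      linarith
    have hexp : Real.exp (β * d) * Real.exp (γ * (b + β) * d) ≤
        Real.exp (ε * q (x' - x)) := by
      rw [← Real.exp_add, Real.exp_le_exp]
      calc β * d + γ * (b + β) * d ≤ ε * d := by
            rw [hε]; nlinarith [mul_nonneg hb.le hd0]
        _ ≤ _ := mul_le_mul_of_nonneg_left (hq _) hε0
    rw [← mul_div_assoc (c x' / c x) _ Z, ← mul_div_assoc _ _ Z]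
    refine div_le_div_of_nonneg_right ?_ hZ0
    have hpz : 0 < 1 + |z| ^ γ := by positivity
    have hpu : 0 < 1 + |u| ^ γ := by positivity
    rw [mul_one_div, mul_one_div, div_le_div_iff₀ hpu hpz]
    calc c x' / c x * (1 + |z| ^ γ)
        ≤ Real.exp (β * d) * (Real.exp (γ * (b + β) * d) * (1 + |u| ^ γ)) := by gcongr
      _ = Real.exp (β * d) * Real.exp (γ * (b + β) * d) * (1 + |u| ^ γ) := by ring
      _ ≤ _ := by gcongr
  rw [hμ, withDensity_apply _ (hmeas x), withDensity_apply _ (hmeas x'),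
    ← lintegral_indicator (hmeas x), ← lintegral_indicator (hmeas x'),
    aux_affine _ (hm.indicator (hmeas x)) (c x' / c x) ((f x' - f x) * b / c x)
      (div_pos hcx' hcx),
    ← lintegral_const_mul' _ _ ENNReal.ofReal_ne_top,
    ← lintegral_const_mul' _ _ ENNReal.ofReal_ne_top]
  refine lintegral_mono fun z => ?_
  have heq : f x + c x / b * (c x' / c x * z + (f x' - f x) * b / c x) =
      f x' + c x' / b * z := by
    field_simp; ring
  by_cases hz : f x' + c x' / b * z ∈ S
  · have h1 : z ∈ {z | f x' + (c x' / b) * z ∈ S} := hz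
    have h2 : (c x' / c x * z + (f x' - f x) * b / c x) ∈
        {z | f x + (c x / b) * z ∈ S} := by
      rw [Set.mem_ofPred_eq, heq]; exact hz
    simp only [Set.indicator_of_mem h1, Set.indicator_of_mem h2]
    exact hpt z
  · have h2 : (c x' / c x * z + (f x' - f x) * b / c x) ∉
        {z | f x + (c x / b) * z ∈ S} := by
      rw [Set.mem_ofPred_eq, heq]; exact hz
    simp only [Set.indicator_of_notMem h2, mul_zero]
    exact zero_le
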